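/- Let M₄ be the Turing machine with states {A,B,C,D,E,F,H} and symbols {0,1} whose transition table is: δ(A,0)=(1,R,B), δ(A,1)=(1,L,E); δ(B,0)=(1,R,C), δ(B,1)=(1,R,F); δ(C,0)=(1,L,D), δ(C,1)=(0,R,B); δ(D,0)=(1,R,E), δ(D,1)=(0,L,C); δ(E,0)=(1,L,A), δ(E,1)=(0,R,D); δ(F,0)=(1,R,H), δ(F,1)=(1,R,C). Let C(n) = ^ω0 (A0) 1^n 0^ω. Then: (a) C(0) ⊢(29) C(9); (b) C(2) ⊢(36) C(11); (c) C(3) ⊢(48) C(13); and for all k ≥ 0: (d) C(3k+1) ⊢(3k+3) ^ω0 1 1 1 (011)^k (H0) 0^ω; (e) C(9k+5) ⊢((4802·16^{k+1} + 6370·4^{k+1} + 2280k − 25362)/270) C((98·4^k − 11)/3); (f) C(9k+6) ⊢((125·16^{k+2} − 575·4^{k+2} + 228k − 2226)/27) C((50·4^{k+1} − 59)/3); (g) C(9k+8) ⊢((4802·16^{k+1} + 6370·4^{k+1} + 2280k − 11592)/270) C((98·4^k + 1)/3); (h) C(9k+9) ⊢((125·16^{k+2} + 325·4^{k+2} + 228k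 − 2289)/27) C((50·4^{k+1} − 11)/3); (i) C(9k+11) ⊢((4802·16^{k+2} − 11270·4^{k+2} + 2280k − 22452)/270) C((98·4^{k+1} − 59)/3); (j) C(9k+12) ⊢((125·16^{k+2} + 325·4^{k+2} + 228k − 912)/27) C((50·4^{k+1} + 1)/3). (All the displayed fractions are integers.) -/

import Mathlib

open Turing

inductive TSt where | A | B | C | D | E | F | H
deriving DecidableEq

inductive Gam where | s0 | s1
deriving DecidableEq

instance : Inhabited Gam := ⟨Gam.s0⟩

abbrev Cfg := TSt × Tape Gam

/-- The transition table of the machine (values from the halting state `H` are never used). -/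
def delta : TSt → Gam → Gam × Dir × TSt
  | .A, .s0 => (.s1, Dir.right, .B)
  | .A, .s1 => (.s1, Dir.left, .E)
  | .B, .s0 => (.s1, Dir.right, .C)
  | .B, .s1 => (.s1, Dir.right, .F)
  | .C, .s0 => (.s1, Dir.left, .D)
  | .C, .s1 => (.s0, Dir.right, .B)
  | .D, .s0 => (.s1, Dir.right, .E)
  | .D, .s1 => (.s0, Dir.left, .C)
  | .E, .s0 => (.s1, Dir.left, .A)
  | .E, .s1 => (.s0, Dir.right, .D)
  | .F, .s0 => (.s1, Dir.right, .H)
  | .F, .s1 => (.s1, Dir.right, .C)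
  | .H, a => (a, Dir.right, .H)

/-- One computation step; `none` if the current state is the halting state `H`. -/
def step (c : Cfg) : Option Cfg :=
  if c.1 = TSt.H then none
  else
    let t := delta c.1 c.2.head
    some (t.2.2, (c.2.write t.1).move t.2.1)

/-- `reaches t c₁ c₂` : iterating `step` exactly `t` times starting from `c₁` yields `c₂`. -/
def reaches (t : ℕ) (c₁ c₂ : Cfg) : Prop :=
  (fun c => Option.bind c step)^[t] (some c₁) = some c₂

/-- The configuration `^ω0 x (q a) y 0^ω` : state `q`, head reading `a`, the word `x`
written immediately to the left of the head (in order), `y` immediately to the right,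
blank elsewhere. -/
def mkCfg (x : List Gam) (q : TSt) (a : Gam) (y : List Gam) : Cfg :=
  (q, ⟨a, ListBlank.mk x.reverse, ListBlank.mk y⟩)

/-- `C(n) = ^ω0 (A0) 1^n 0^ω`. -/
def Cfg4 (n : ℕ) : Cfg := mkCfg [] .A .s0 (List.replicate n .s1)

namespace SixStateMachine

/-- The half-tape consisting of blank cells only. -/
def blank : ListBlank Gam := ListBlank.mk []

/-- Put a cell holding `0` in front of a half-tape. -/
def zero (l : ListBlank Gam) : ListBlank Gam := ListBlank.cons .s0 l

/-- Put a cell holding `1` in front of a half-tape. -/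
def one (l : ListBlank Gam) : ListBlank Gam := ListBlank.cons .s1 l

/-- The configuration in state `q` whose head stands on the first cell of `r`,
with `l` the half-tape to its left (nearest cell first). -/
def conf (l : ListBlank Gam) (q : TSt) (r : ListBlank Gam) : Cfg := (q, ⟨r.head, l, r.tail⟩)

theorem zero_blank : zero blank = blank :=
  Quotient.sound (Or.inr ⟨1, rfl⟩)

theorem reaches_zero {c c' : Cfg} : reaches 0 c c' ↔ c = c' := by
  simp [reaches]

theorem reaches_succ {n : ℕ} {c d e : Cfg} (h : step c = some d) :
    reaches (n + 1) c e ↔ reaches n d e := by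
  simp [reaches, Function.iterate_succ_apply, h]

theorem _root_.reaches.trans {s t : ℕ} {c d e : Cfg} (h₁ : reaches s c d) (h₂ : reaches t d e) :
    reaches (s + t) c e := by
  unfold reaches at *
  rw [add_comm, Function.iterate_add_apply, h₁, h₂]

theorem _root_.reaches.congr {s t : ℕ} {c d e : Cfg} (h : reaches s c d) (hs : s = t)
    (hd : d = e) : reaches t c e :=
  hs ▸ hd ▸ h

theorem conf_blank_left (q : TSt) (r : ListBlank Gam) :
    conf blank q r = conf (zero blank) q r := by rw [zero_blank]

theorem conf_blank_right (l : ListBlank Gam) (q : TSt) :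
    conf l q blank = conf l q (zero blank) := by rw [zero_blank]

section Steps

variable {n : ℕ} {l r : ListBlank Gam} {c : Cfg}

theorem reaches_A_zero :
    reaches (n + 1) (conf l .A (zero r)) c ↔ reaches n (conf (one l) .B r) c :=
  reaches_succ (by simp [step, conf, zero, one, delta, Tape.move, Tape.write])

theorem reaches_A_one_zero :
    reaches (n + 1) (conf (zero l) .A (one r)) c ↔ reaches n (conf l .E (zero (one r))) c :=
  reaches_succ (by simp [step, conf, zero, one, delta, Tape.move, Tape.write])

theorem reaches_A_one_one :
    reaches (n + 1) (conf (one l) .A (one r)) c ↔ reaches n (conf l .E (one (one r))) c :=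
  reaches_succ (by simp [step, conf, one, delta, Tape.move, Tape.write])

theorem reaches_B_zero :
    reaches (n + 1) (conf l .B (zero r)) c ↔ reaches n (conf (one l) .C r) c :=
  reaches_succ (by simp [step, conf, zero, one, delta, Tape.move, Tape.write])

theorem reaches_B_one :
    reaches (n + 1) (conf l .B (one r)) c ↔ reaches n (conf (one l) .F r) c :=
  reaches_succ (by simp [step, conf, one, delta, Tape.move, Tape.write])

theorem reaches_C_zero_zero :
    reaches (n + 1) (conf (zero l) .C (zero r)) c ↔ reaches n (conf l .D (zero (one r))) c :=
  reaches_succ (by simp [step, conf, zero, one, delta, Tape.move, Tape.write])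

theorem reaches_C_zero_one :
    reaches (n + 1) (conf (one l) .C (zero r)) c ↔ reaches n (conf l .D (one (one r))) c :=
  reaches_succ (by simp [step, conf, zero, one, delta, Tape.move, Tape.write])

theorem reaches_C_one :
    reaches (n + 1) (conf l .C (one r)) c ↔ reaches n (conf (zero l) .B r) c :=
  reaches_succ (by simp [step, conf, zero, one, delta, Tape.move, Tape.write])

theorem reaches_D_zero :
    reaches (n + 1) (conf l .D (zero r)) c ↔ reaches n (conf (one l) .E r) c :=
  reaches_succ (by simp [step, conf, zero, one, delta, Tape.move, Tape.write])

theorem reaches_D_one_zero :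
    reaches (n + 1) (conf (zero l) .D (one r)) c ↔ reaches n (conf l .C (zero (zero r))) c :=
  reaches_succ (by simp [step, conf, zero, one, delta, Tape.move, Tape.write])

theorem reaches_D_one_one :
    reaches (n + 1) (conf (one l) .D (one r)) c ↔ reaches n (conf l .C (one (zero r))) c :=
  reaches_succ (by simp [step, conf, zero, one, delta, Tape.move, Tape.write])

theorem reaches_E_zero_zero :
    reaches (n + 1) (conf (zero l) .E (zero r)) c ↔ reaches n (conf l .A (zero (one r))) c :=
  reaches_succ (by simp [step, conf, zero, one, delta, Tape.move, Tape.write])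

theorem reaches_E_zero_one :
    reaches (n + 1) (conf (one l) .E (zero r)) c ↔ reaches n (conf l .A (one (one r))) c :=
  reaches_succ (by simp [step, conf, zero, one, delta, Tape.move, Tape.write])

theorem reaches_E_one :
    reaches (n + 1) (conf l .E (one r)) c ↔ reaches n (conf (zero l) .D r) c :=
  reaches_succ (by simp [step, conf, zero, one, delta, Tape.move, Tape.write])

theorem reaches_F_zero :
    reaches (n + 1) (conf l .F (zero r)) c ↔ reaches n (conf (one l) .H r) c :=
  reaches_succ (by simp [step, conf, zero, one, delta, Tape.move, Tape.write])

theorem reaches_F_one :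
    reaches (n + 1) (conf l .F (one r)) c ↔ reaches n (conf (one l) .C r) c :=
  reaches_succ (by simp [step, conf, one, delta, Tape.move, Tape.write])

end Steps

attribute [local simp] reaches_zero reaches_A_zero reaches_A_one_zero reaches_A_one_one
  reaches_B_zero reaches_B_one reaches_C_zero_zero reaches_C_zero_one reaches_C_one
  reaches_D_zero reaches_D_one_zero reaches_D_one_one reaches_E_zero_zero reaches_E_zero_one
  reaches_E_one reaches_F_zero reaches_F_one conf_blank_left conf_blank_right

/-- Append the word `10` to a left half-tape. -/
def oneZero (l : ListBlank Gam) : ListBlank Gam := zero (one l)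

/-- Append the word `01` to a left half-tape. -/
def zeroOne (l : ListBlank Gam) : ListBlank Gam := one (zero l)

/-- Append the word `011` to a left half-tape. -/
def zeroOneOne (l : ListBlank Gam) : ListBlank Gam := one (one (zero l))

theorem iterate_oneZero_zero (a : ℕ) (l : ListBlank Gam) :
    oneZero^[a] (zero l) = zero (zeroOne^[a] l) := by
  induction a with
  | zero => rfl
  | succ a ih => rw [Function.iterate_succ_apply', ih, Function.iterate_succ_apply']; rfl

theorem reaches_D_leftward (a : ℕ) (l r : ListBlank Gam) :
    reaches (2 * a) (conf (oneZero^[a] l) .D (one r)) (conf l .D (one (zeroOne^[a] r))) := by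
  induction a generalizing r with
  | zero => simp
  | succ a ih =>
    rw [Function.iterate_succ_apply', Function.iterate_succ_apply, mul_add]
    simpa [oneZero, zeroOne] using ih _

theorem reaches_B_rightward (a : ℕ) (l r : ListBlank Gam) :
    reaches (2 * a) (conf l .B (oneZero^[a] r)) (conf (oneZero^[a] l) .B r) := by
  induction a generalizing l with
  | zero => simp
  | succ a ih =>
    rw [Function.iterate_succ_apply', Function.iterate_succ_apply, mul_add]
    simpa [oneZero, zeroOne] using ih _

theorem reaches_D_rightward (a : ℕ) (l r : ListBlank Gam) :
    reaches (2 * a) (conf l .D (oneZero^[a] r)) (conf (oneZero^[a] l) .D r) := by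
  induction a generalizing l with
  | zero => simp
  | succ a ih =>
    rw [Function.iterate_succ_apply', Function.iterate_succ_apply, mul_add]
    simpa [oneZero] using ih _

theorem reaches_C_rightward (a : ℕ) (l r : ListBlank Gam) :
    reaches (3 * a) (conf l .C (one^[3 * a] r)) (conf (zeroOneOne^[a] l) .C r) := by
  induction a generalizing l with
  | zero => simp
  | succ a ih =>
    rw [Function.iterate_succ_apply, mul_add]
    simpa [zeroOneOne, Function.iterate_succ_apply'] using ih _

theorem reaches_A_leftward (a : ℕ) (l r : ListBlank Gam) :
    reaches (2 * a) (conf (oneZero^[a] l) .A (one r)) (conf l .A (one (one^[2 * a] r))) := by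
  induction a generalizing r with
  | zero => simp
  | succ a ih =>
    rw [Function.iterate_succ_apply', mul_add, Function.iterate_add_apply]
    simpa [oneZero] using ih _

/-- The configuration `l (10)^a (D1) 1^b 0^ω`. -/
def bounce (l : ListBlank Gam) (a b : ℕ) : Cfg := conf (oneZero^[a] l) .D (one^[b + 1] blank)

theorem bounce_oneZero (l : ListBlank Gam) (a b : ℕ) :
    bounce (zero (one l)) a b = bounce l (a + 1) b := by
  rw [bounce, bounce, Function.iterate_succ_apply]; rfl

theorem reaches_bounce_zero_zero (l r : ListBlank Gam) (a : ℕ) :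
    reaches (4 * a + 6) (conf (oneZero^[a] (zero (zero l))) .D (one (one r)))
      (conf (oneZero^[a + 2] l) .D r) := by
  have h₁ : reaches 4 (conf (zero (zero l)) .D (one (zeroOne^[a] (one r))))
      (conf (oneZero l) .D (oneZero^[a] (zero (one r)))) := by
    rw [iterate_oneZero_zero]; simp [oneZero]
  have h₂ : reaches 2 (conf (oneZero^[a] (oneZero l)) .D (zero (one r)))
      (conf (oneZero^[a + 2] l) .D r) := by
    rw [← Function.iterate_succ_apply, Function.iterate_succ_apply' _ (a + 1)]
    simp [oneZero]
  convert (reaches_D_leftward a _ _).trans (h₁.trans ((reaches_D_rightward a _ _).trans h₂))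
    using 1
  ring

theorem reaches_bounce_one (l r : ListBlank Gam) (a : ℕ) :
    reaches (4 * a + 3) (conf (oneZero^[a] (one l)) .D (one r))
      (conf (zeroOne^[a + 1] l) .C r) := by
  have h₁ : reaches 2 (conf (one l) .D (one (zeroOne^[a] r)))
      (conf (zero l) .B (oneZero^[a] (zero r))) := by
    rw [iterate_oneZero_zero]; simp
  have h₂ : reaches 1 (conf (oneZero^[a] (zero l)) .B (zero r))
      (conf (zeroOne^[a + 1] l) .C r) := by
    rw [iterate_oneZero_zero, Function.iterate_succ_apply']
    simp [zeroOne]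
  convert (reaches_D_leftward a _ _).trans (h₁.trans ((reaches_B_rightward a _ _).trans h₂))
    using 1
  ring

theorem bounce_zero_zero (l : ListBlank Gam) (a b : ℕ) :
    reaches (4 * a + 6) (bounce (zero (zero l)) a (b + 2)) (bounce l (a + 2) b) := by
  rw [bounce, Function.iterate_succ_apply', Function.iterate_succ_apply']
  exact reaches_bounce_zero_zero _ _ _

theorem reaches_C_ones_seven (l : ListBlank Gam) :
    reaches 45 (conf (one l) .C (one^[7] blank)) (bounce l 2 9) := by
  simp [bounce, oneZero]

theorem bounce_one_seven (l : ListBlank Gam) (a : ℕ) :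
    reaches (4 * a + 48) (bounce (one l) a 7) (bounce (zero l) (a + 2) 9) := by
  have h₁ : reaches (4 * a + 3) (bounce (one l) a 7)
      (conf (one (zero (zeroOne^[a] l))) .C (one^[7] blank)) := by
    have h := reaches_bounce_one l (one^[7] blank) a
    rw [Function.iterate_succ_apply' zeroOne] at h
    exact h
  refine (h₁.trans (reaches_C_ones_seven (zero (zeroOne^[a] l)))).congr (by ring) ?_
  rw [← iterate_oneZero_zero, bounce, ← Function.iterate_add_apply, add_comm 2 a, bounce]

theorem bounce_zeroOne_iterate (l : ListBlank Gam) (a j : ℕ) :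
    reaches (j * (8 * a + 46) + 16 * j ^ 2) (bounce (zeroOne^[j] l) a 7)
      (bounce l (a + 4 * j) 7) := by
  induction j generalizing a with
  | zero => simp
  | succ j ih =>
    rw [Function.iterate_succ_apply']
    exact ((bounce_one_seven _ a).trans ((bounce_zero_zero _ _ 7).trans (ih (a + 2 + 2)))).congr
      (by ring) (by congr 1; ring)

theorem bounce_zeroOne (l : ListBlank Gam) (a : ℕ) :
    reaches (8 * a + 62) (bounce (one (zero l)) a 7) (bounce l (a + 4) 7) := by
  exact (bounce_zeroOne_iterate l a 1).congr (by ring) rfl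

theorem reaches_C_ones_nine (l : ListBlank Gam) :
    reaches 36 (conf l .C (one^[9] blank)) (bounce (one (zero l)) 2 7) := by
  simp [bounce, oneZero]

theorem bounce_one_nine (l : ListBlank Gam) (a : ℕ) :
    reaches (16 * a ^ 2 + 130 * a + 227) (bounce (one l) a 9) (bounce l (4 * a + 10) 7) := by
  exact ((reaches_bounce_one l (one^[9] blank) a).trans ((reaches_C_ones_nine _).trans
    ((bounce_zeroOne _ 2).trans (bounce_zeroOne_iterate l 6 (a + 1))))).congr
    (by ring) (by congr 1; ring)

theorem Cfg4_eq_conf (n : ℕ) : Cfg4 n = conf blank .A (zero (one^[n] blank)) := by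
  have h : ListBlank.mk (List.replicate n Gam.s1) = one^[n] blank := by
    induction n with
    | zero => rfl
    | succ n ih => rw [Function.iterate_succ_apply', ← ih]; rfl
  simp [Cfg4, mkCfg, conf, zero, blank, h]

theorem bounce_blank_one (a : ℕ) :
    reaches (6 * a + 14) (bounce blank a 1) (Cfg4 (2 * a + 7)) := by
  have h₁ : reaches (4 * a + 6) (bounce blank a 1) (conf (oneZero^[a + 2] blank) .D blank) := by
    have h := reaches_bounce_zero_zero blank blank a
    rwa [zero_blank, zero_blank] at h
  have h₂ (l : ListBlank Gam) : reaches 2 (conf l .D blank) (conf l .A (one (one blank))) := by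
    rw [conf_blank_right]
    simp [-conf_blank_left]
  have h₃ (r : ListBlank Gam) :
      reaches 2 (conf blank .A (one r)) (conf blank .A (zero (one (one r)))) := by
    simp
  refine (h₁.trans ((h₂ _).trans ((reaches_A_leftward (a + 2) _ _).trans (h₃ _)))).congr
    (by ring) ?_
  rw [Cfg4_eq_conf, ← Function.iterate_succ_apply, ← Function.iterate_succ_apply' one,
    ← Function.iterate_succ_apply' one]
  rfl

theorem bounce_blank_seven (a : ℕ) :
    reaches (18 * a + 92) (bounce blank a 7) (Cfg4 (2 * a + 19)) := by
  have h (a b : ℕ) := bounce_zero_zero blank a b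
  simp only [zero_blank] at h
  exact ((h a 5).trans ((h _ 3).trans ((h _ 1).trans (bounce_blank_one _)))).congr (by ring) rfl

theorem bounce_blank_nine (a : ℕ) :
    reaches (22 * a + 134) (bounce blank a 9) (Cfg4 (2 * a + 23)) := by
  have h := bounce_zero_zero blank a 7
  simp only [zero_blank] at h
  exact (h.trans (bounce_blank_seven _)).congr (by ring) rfl

theorem bounce_zeroOneOne_three (l : ListBlank Gam) (a : ℕ) :
    reaches (16 * a ^ 2 + 294 * a + 1329) (bounce (zeroOneOne^[3] l) a 7)
      (bounce l (4 * a + 31) 7) := by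
  have h₁ := bounce_one_seven (one (zero (zeroOneOne (zeroOneOne l)))) a
  have h₂ := bounce_one_nine (zero (zeroOneOne l)) (a + 4)
  have h₃ := bounce_zeroOne l (4 * a + 27)
  rw [bounce_oneZero] at h₁
  simp only [zeroOneOne] at h₁ h₂
  rw [bounce_oneZero] at h₁ h₂
  exact (h₁.trans (h₂.trans h₃)).congr (by ring) rfl

theorem bounce_zeroOneOne_iterate (l : ListBlank Gam) (a k : ℕ) :
    ∃ t b, reaches t (bounce (zeroOneOne^[3 * k] l) a 7) (bounce l b 7) ∧
      3 * b + 31 = 4 ^ k * (3 * a + 31) ∧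
      135 * t + 16 * (3 * a + 31) ^ 2 + 550 * (3 * b + 31) + 75 * k =
        16 * (3 * b + 31) ^ 2 + 550 * (3 * a + 31) := by
  induction k generalizing a with
  | zero => exact ⟨0, a, by simp, by simp, by ring⟩
  | succ k ih =>
    obtain ⟨t, b, h, hb, ht⟩ := ih (4 * a + 31)
    refine ⟨16 * a ^ 2 + 294 * a + 1329 + t, b, ?_, ?_, ?_⟩
    · rw [show 3 * (k + 1) = 3 + 3 * k by ring, Function.iterate_add_apply]
      exact (bounce_zeroOneOne_three _ a).trans h
    · rw [hb]; ring
    · zify at ht ⊢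
      linear_combination ht

/-- The half-tape to the left of the head when `111(011)^j` is written there. -/
def block (j : ℕ) : ListBlank Gam := zeroOneOne^[j] (one (one (one blank)))

theorem bounce_block_zero (a : ℕ) :
    reaches (16 * a ^ 2 + 302 * a + 1297) (bounce (block 0) a 7) (Cfg4 (8 * a + 63)) := by
  have h₁ := bounce_one_seven (one (one blank)) a
  rw [bounce_oneZero] at h₁
  exact (h₁.trans ((bounce_one_nine blank _).trans (bounce_blank_seven _))).congr
    (by ring) (congrArg Cfg4 (by ring))

theorem bounce_block_one (a : ℕ) :
    reaches (16 * a ^ 2 + 366 * a + 1953) (bounce (block 1) a 7) (Cfg4 (8 * a + 79)) := by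
  have h₁ := bounce_one_seven (one (zero (one (one (one blank))))) a
  have h₂ := bounce_one_seven blank (4 * a + 26)
  rw [bounce_oneZero, bounce_oneZero] at h₁
  rw [zero_blank] at h₂
  exact (h₁.trans ((bounce_one_nine _ _).trans (h₂.trans (bounce_blank_nine _)))).congr
    (by ring) (congrArg Cfg4 (by ring))

theorem bounce_block_two (a : ℕ) :
    reaches (16 * a ^ 2 + 366 * a + 2001) (bounce (block 2) a 7) (Cfg4 (8 * a + 83)) := by
  have h₁ := bounce_one_seven (one (zero (zeroOneOne (one (one (one blank)))))) a
  have h₂ := bounce_one_nine (zero (one (one (one blank)))) (a + 4)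
  have h₃ := bounce_one_seven (one blank) (4 * a + 27)
  simp only [zeroOneOne] at h₁
  rw [bounce_oneZero, bounce_oneZero] at h₁
  rw [bounce_oneZero] at h₂ h₃
  exact (h₁.trans (h₂.trans (h₃.trans (bounce_blank_nine _)))).congr
    (by ring) (congrArg Cfg4 (by ring))

theorem Cfg4_add_two (n : ℕ) :
    reaches 3 (Cfg4 (n + 2)) (conf (one (one (one blank))) .C (one^[n] blank)) := by
  rw [Cfg4_eq_conf, Function.iterate_succ_apply', Function.iterate_succ_apply']
  simp [-conf_blank_left]

theorem Cfg4_add_block (n j : ℕ) :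
    reaches (3 * j + 3) (Cfg4 (3 * j + n + 2)) (conf (block j) .C (one^[n] blank)) := by
  have h := (Cfg4_add_two (3 * j + n)).trans
    ((Function.iterate_add_apply one (3 * j) n blank) ▸ reaches_C_rightward j _ _)
  rwa [add_comm] at h

theorem Cfg4_three_mul_add_one (k : ℕ) :
    reaches (3 * k + 3) (Cfg4 (3 * k + 1))
      (mkCfg ([.s1, .s1, .s1] ++ (List.replicate k [Gam.s0, .s1, .s1]).flatten) .H .s0 []) := by
  have hl : block k = ListBlank.mk
      ([Gam.s1, .s1, .s1] ++ (List.replicate k [Gam.s0, .s1, .s1]).flatten).reverse := by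
    induction k with
    | zero => rfl
    | succ k ih =>
      rw [block, Function.iterate_succ_apply', ← block, ih, List.replicate_succ']
      simp [zeroOneOne, one, zero, ListBlank.cons_mk]
  have hH : mkCfg ([.s1, .s1, .s1] ++ (List.replicate k [Gam.s0, .s1, .s1]).flatten) .H .s0 [] =
      conf (block k) .H blank := by
    rw [hl]; rfl
  rw [hH]
  cases k with
  | zero => simp [Cfg4_eq_conf, block, zero_blank]
  | succ k =>
    have h : reaches 3 (conf (block k) .C (one (one blank))) (conf (block (k + 1)) .H blank) := by
      rw [block, block, Function.iterate_succ_apply']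
      simp [zeroOneOne]
    exact ((Cfg4_add_block 2 k).trans h).congr (by ring) rfl

theorem reaches_C_blank (l : ListBlank Gam) :
    reaches 27 (conf (zeroOneOne (one (one l))) .C blank) (bounce l 1 7) := by
  simp [bounce, oneZero, zeroOneOne]

theorem reaches_C_one_blank (l : ListBlank Gam) :
    reaches 39 (conf (zeroOneOne (one (one l))) .C (one blank)) (bounce l 1 9) := by
  simp [bounce, oneZero, zeroOneOne]

/-- Sweep over a long run of ones and consume the last three of the resulting `011` words. -/
theorem Cfg4_bounce_block (j : ℕ) :
    reaches (3 * j + 117) (Cfg4 (3 * j + 11)) (bounce (block j) 6 7) := by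
  have h₁ := Cfg4_add_block 0 (j + 3)
  have h₂ := reaches_C_blank (zero (zeroOneOne (block j)))
  have hb : block (j + 3) = zeroOneOne (one (one (zero (zeroOneOne (block j))))) := by
    simp only [block, Function.iterate_succ_apply' zeroOneOne]
    rfl
  rw [hb] at h₁
  have h₃ := bounce_zeroOne (block j) 2
  simp only [zeroOneOne] at h₁ h₂
  rw [bounce_oneZero] at h₂
  exact (h₁.trans (h₂.trans h₃)).congr (by ring) rfl

/-- The analogue of `Cfg4_bounce_block` for a run of ones whose length is divisible by three. -/
theorem Cfg4_bounce_block' (j : ℕ) :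
    reaches (3 * j + 819) (Cfg4 (3 * j + 15)) (bounce (block j) 23 7) := by
  have h₁ := Cfg4_add_block 1 (j + 4)
  have h₂ := reaches_C_one_blank (zero (zeroOneOne (zeroOneOne (block j))))
  have h₃ := bounce_one_nine (zero (zeroOneOne (block j))) 2
  have hb : block (j + 4) =
      zeroOneOne (one (one (zero (zeroOneOne (zeroOneOne (block j)))))) := by
    simp only [block, Function.iterate_succ_apply' zeroOneOne]
    rfl
  rw [hb] at h₁
  simp only [zeroOneOne] at h₁ h₂ h₃
  rw [bounce_oneZero] at h₂ h₃
  exact (h₁.trans (h₂.trans (h₃.trans (bounce_zeroOne (block j) 19)))).congr (by ring) rfl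

theorem bounce_block_add (r a k : ℕ) :
    ∃ t b, reaches t (bounce (block (3 * k + r)) a 7) (bounce (block r) b 7) ∧
      3 * b + 31 = 4 ^ k * (3 * a + 31) ∧
      135 * t + 16 * (3 * a + 31) ^ 2 + 550 * (3 * b + 31) + 75 * k =
        16 * (3 * b + 31) ^ 2 + 550 * (3 * a + 31) := by
  rw [block, Function.iterate_add_apply]
  exact bounce_zeroOneOne_iterate _ _ _

theorem sixteen_pow (k : ℕ) : 16 ^ k = (4 ^ k) ^ 2 := by
  rw [← pow_mul, mul_comm, pow_mul]
  norm_num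

theorem mul_four_pow_le_sixteen_pow (k : ℕ) : 16 * 4 ^ (k + 2) ≤ 16 ^ (k + 2) := by
  rw [sixteen_pow, sq]
  refine Nat.mul_le_mul_right _ ?_
  calc 16 = 4 ^ 2 := by norm_num
    _ ≤ 4 ^ (k + 2) := Nat.pow_le_pow_right (by norm_num) (by omega)

theorem Cfg4_nine_mul_add_five (k : ℕ) :
    reaches ((4802 * 16 ^ (k + 1) + 6370 * 4 ^ (k + 1) + 2280 * k - 25362) / 270)
      (Cfg4 (9 * k + 5)) (Cfg4 ((98 * 4 ^ k - 11) / 3)) := by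
  cases k with
  | zero =>
    have h := bounce_one_seven blank 1
    rw [zero_blank] at h
    exact ((Cfg4_add_block 0 1).trans ((reaches_C_blank (one blank)).trans
      (h.trans (bounce_blank_nine 3)))).congr (by norm_num) (congrArg Cfg4 (by norm_num))
  | succ k =>
    obtain ⟨t, b, h, hb, ht⟩ := bounce_block_add 1 6 k
    rw [show 9 * (k + 1) + 5 = 3 * (3 * k + 1) + 11 by ring]
    refine ((Cfg4_bounce_block _).trans (h.trans (bounce_block_one b))).congr ?_
      (congrArg Cfg4 ?_)
    · have key : 4802 * 16 ^ (k + 1 + 1) + 6370 * 4 ^ (k + 1 + 1) + 2280 * (k + 1) = 25362 + 270 *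
            (3 * (3 * k + 1) + 117 + (t + (16 * b ^ 2 + 366 * b + 1953))) := by
        rw [sixteen_pow]
        zify at *
        linear_combination -2 * ht - (512 * (3 * b + 31 + 49 * 4 ^ k) + 2080) * hb
      rw [key, Nat.add_sub_cancel_left, Nat.mul_div_cancel_left _ (by norm_num)]
    · simp only [pow_succ]
      omega

theorem Cfg4_nine_mul_add_six (k : ℕ) :
    reaches ((125 * 16 ^ (k + 2) - 575 * 4 ^ (k + 2) + 228 * k - 2226) / 27)
      (Cfg4 (9 * k + 6)) (Cfg4 ((50 * 4 ^ (k + 1) - 59) / 3)) := by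
  cases k with
  | zero =>
    exact ((Cfg4_add_block 1 1).trans ((reaches_C_one_blank (one blank)).trans
      ((bounce_one_nine blank 1).trans (bounce_blank_seven 14)))).congr
        (by norm_num) (congrArg Cfg4 (by norm_num))
  | succ k =>
    obtain ⟨t, b, h, hb, ht⟩ := bounce_block_add 0 23 k
    rw [show 9 * (k + 1) + 6 = 3 * (3 * k + 0) + 15 by ring]
    refine ((Cfg4_bounce_block' _).trans (h.trans (bounce_block_zero b))).congr ?_
      (congrArg Cfg4 ?_)
    · have key : 125 * 16 ^ (k + 1 + 2) + 228 * (k + 1) = 575 * 4 ^ (k + 1 + 2) + (2226 + 27 *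
            (3 * (3 * k + 0) + 819 + (t + (16 * b ^ 2 + 302 * b + 1297)))) := by
        refine Nat.eq_of_mul_eq_mul_left (by norm_num : 0 < 5) ?_
        rw [sixteen_pow]
        zify at *
        linear_combination -ht - (256 * (3 * b + 31 + 100 * 4 ^ k) - 1840) * hb
      have hle : 575 * 4 ^ (k + 1 + 2) ≤ 125 * 16 ^ (k + 1 + 2) := by
        linarith [mul_four_pow_le_sixteen_pow (k + 1)]
      rw [← Nat.sub_add_comm hle, key, Nat.add_sub_cancel_left,
        Nat.add_sub_cancel_left, Nat.mul_div_cancel_left _ (by norm_num)]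
    · simp only [pow_succ]
      omega

theorem Cfg4_nine_mul_add_eight (k : ℕ) :
    reaches ((4802 * 16 ^ (k + 1) + 6370 * 4 ^ (k + 1) + 2280 * k - 11592) / 270)
      (Cfg4 (9 * k + 8)) (Cfg4 ((98 * 4 ^ k + 1) / 3)) := by
  cases k with
  | zero =>
    have h₁ := reaches_C_blank (zero (one (one (one blank))))
    have h₂ := bounce_one_seven (one blank) 2
    rw [bounce_oneZero] at h₁ h₂
    exact ((Cfg4_add_block 0 2).trans (h₁.trans (h₂.trans (bounce_blank_nine 5)))).congr
      (by norm_num) (congrArg Cfg4 (by norm_num))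
  | succ k =>
    obtain ⟨t, b, h, hb, ht⟩ := bounce_block_add 2 6 k
    rw [show 9 * (k + 1) + 8 = 3 * (3 * k + 2) + 11 by ring]
    refine ((Cfg4_bounce_block _).trans (h.trans (bounce_block_two b))).congr ?_
      (congrArg Cfg4 ?_)
    · have key : 4802 * 16 ^ (k + 1 + 1) + 6370 * 4 ^ (k + 1 + 1) + 2280 * (k + 1) = 11592 + 270 *
            (3 * (3 * k + 2) + 117 + (t + (16 * b ^ 2 + 366 * b + 2001))) := by
        rw [sixteen_pow]
        zify at *
        linear_combination -2 * ht - (512 * (3 * b + 31 + 49 * 4 ^ k) + 2080) * hb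
      rw [key, Nat.add_sub_cancel_left, Nat.mul_div_cancel_left _ (by norm_num)]
    · simp only [pow_succ]
      omega

theorem Cfg4_nine_mul_add_nine (k : ℕ) :
    reaches ((125 * 16 ^ (k + 2) + 325 * 4 ^ (k + 2) + 228 * k - 2289) / 27)
      (Cfg4 (9 * k + 9)) (Cfg4 ((50 * 4 ^ (k + 1) - 11) / 3)) := by
  cases k with
  | zero =>
    have h₁ := reaches_C_one_blank (zero (one (one (one blank))))
    have h₂ := bounce_one_seven blank 18
    rw [bounce_oneZero] at h₁
    rw [zero_blank] at h₂
    exact ((Cfg4_add_block 1 2).trans (h₁.trans ((bounce_one_nine (one blank) 2).trans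
      (h₂.trans (bounce_blank_nine 20))))).congr (by norm_num) (congrArg Cfg4 (by norm_num))
  | succ k =>
    obtain ⟨t, b, h, hb, ht⟩ := bounce_block_add 1 23 k
    rw [show 9 * (k + 1) + 9 = 3 * (3 * k + 1) + 15 by ring]
    refine ((Cfg4_bounce_block' _).trans (h.trans (bounce_block_one b))).congr ?_
      (congrArg Cfg4 ?_)
    · have key : 125 * 16 ^ (k + 1 + 2) + 325 * 4 ^ (k + 1 + 2) + 228 * (k + 1) = 2289 + 27 *
            (3 * (3 * k + 1) + 819 + (t + (16 * b ^ 2 + 366 * b + 1953))) := by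
        refine Nat.eq_of_mul_eq_mul_left (by norm_num : 0 < 5) ?_
        rw [sixteen_pow]
        zify at *
        linear_combination -ht - (256 * (3 * b + 31 + 100 * 4 ^ k) + 1040) * hb
      rw [key, Nat.add_sub_cancel_left, Nat.mul_div_cancel_left _ (by norm_num)]
    · simp only [pow_succ]
      omega

theorem Cfg4_nine_mul_add_eleven (k : ℕ) :
    reaches ((4802 * 16 ^ (k + 2) - 11270 * 4 ^ (k + 2) + 2280 * k - 22452) / 270)
      (Cfg4 (9 * k + 11)) (Cfg4 ((98 * 4 ^ (k + 1) - 59) / 3)) := by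
  obtain ⟨t, b, h, hb, ht⟩ := bounce_block_add 0 6 k
  rw [show 9 * k + 11 = 3 * (3 * k + 0) + 11 by ring]
  refine ((Cfg4_bounce_block _).trans (h.trans (bounce_block_zero b))).congr ?_
    (congrArg Cfg4 ?_)
  · have key : 4802 * 16 ^ (k + 2) + 2280 * k = 11270 * 4 ^ (k + 2) + (22452 + 270 *
          (3 * (3 * k + 0) + 117 + (t + (16 * b ^ 2 + 302 * b + 1297)))) := by
      rw [sixteen_pow]
      zify at *
      linear_combination -2 * ht - (512 * (3 * b + 31 + 49 * 4 ^ k) - 3680) * hb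
    have hle : 11270 * 4 ^ (k + 2) ≤ 4802 * 16 ^ (k + 2) := by
      linarith [mul_four_pow_le_sixteen_pow k]
    rw [← Nat.sub_add_comm hle, key, Nat.add_sub_cancel_left,
      Nat.add_sub_cancel_left, Nat.mul_div_cancel_left _ (by norm_num)]
  · simp only [pow_succ]
    omega

theorem Cfg4_nine_mul_add_twelve (k : ℕ) :
    reaches ((125 * 16 ^ (k + 2) + 325 * 4 ^ (k + 2) + 228 * k - 912) / 27)
      (Cfg4 (9 * k + 12)) (Cfg4 ((50 * 4 ^ (k + 1) + 1) / 3)) := by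
  cases k with
  | zero =>
    have h₁ := reaches_C_one_blank (zero (zeroOneOne (one (one (one blank)))))
    have h₂ := bounce_one_nine (zero (one (one (one blank)))) 2
    have h₃ := bounce_one_seven (one blank) 19
    simp only [zeroOneOne] at h₁
    rw [bounce_oneZero] at h₁ h₂ h₃
    exact ((Cfg4_add_block 1 3).trans (h₁.trans (h₂.trans
      (h₃.trans (bounce_blank_nine 22))))).congr (by norm_num) (congrArg Cfg4 (by norm_num))
  | succ k =>
    obtain ⟨t, b, h, hb, ht⟩ := bounce_block_add 2 23 k
    rw [show 9 * (k + 1) + 12 = 3 * (3 * k + 2) + 15 by ring]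
    refine ((Cfg4_bounce_block' _).trans (h.trans (bounce_block_two b))).congr ?_
      (congrArg Cfg4 ?_)
    · have key : 125 * 16 ^ (k + 1 + 2) + 325 * 4 ^ (k + 1 + 2) + 228 * (k + 1) = 912 + 27 *
            (3 * (3 * k + 2) + 819 + (t + (16 * b ^ 2 + 366 * b + 2001))) := by
        refine Nat.eq_of_mul_eq_mul_left (by norm_num : 0 < 5) ?_
        rw [sixteen_pow]
        zify at *
        linear_combination -ht - (256 * (3 * b + 31 + 100 * 4 ^ k) + 1040) * hb
      rw [key, Nat.add_sub_cancel_left, Nat.mul_div_cancel_left _ (by norm_num)]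
    · simp only [pow_succ]
      omega

theorem Cfg4_zero : reaches 29 (Cfg4 0) (Cfg4 9) := by
  simp [Cfg4_eq_conf]

theorem Cfg4_two : reaches 36 (Cfg4 2) (Cfg4 11) := by
  simp [Cfg4_eq_conf]

theorem Cfg4_three : reaches 48 (Cfg4 3) (Cfg4 13) := by
  simp [Cfg4_eq_conf]

end SixStateMachine

theorem stmt8 :
    reaches 29 (Cfg4 0) (Cfg4 9) ∧
    reaches 36 (Cfg4 2) (Cfg4 11) ∧
    reaches 48 (Cfg4 3) (Cfg4 13) ∧
    ∀ k : ℕ,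
      reaches (3*k + 3) (Cfg4 (3*k+1))
        (mkCfg ([.s1, .s1, .s1] ++ (List.replicate k [Gam.s0, .s1, .s1]).flatten) .H .s0 []) ∧
      reaches ((4802*16^(k+1) + 6370*4^(k+1) + 2280*k - 25362)/270)
        (Cfg4 (9*k+5)) (Cfg4 ((98*4^k - 11)/3)) ∧
      reaches ((125*16^(k+2) - 575*4^(k+2) + 228*k - 2226)/27)
        (Cfg4 (9*k+6)) (Cfg4 ((50*4^(k+1) - 59)/3)) ∧
      reaches ((4802*16^(k+1) + 6370*4^(k+1) + 2280*k - 11592)/270)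
        (Cfg4 (9*k+8)) (Cfg4 ((98*4^k + 1)/3)) ∧
      reaches ((125*16^(k+2) + 325*4^(k+2) + 228*k - 2289)/27)
        (Cfg4 (9*k+9)) (Cfg4 ((50*4^(k+1) - 11)/3)) ∧
      reaches ((4802*16^(k+2) - 11270*4^(k+2) + 2280*k - 22452)/270)
        (Cfg4 (9*k+11)) (Cfg4 ((98*4^(k+1) - 59)/3)) ∧
      reaches ((125*16^(k+2) + 325*4^(k+2) + 228*k - 912)/27)
        (Cfg4 (9*k+12)) (Cfg4 ((50*4^(k+1) + 1)/3)) := by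
  exact ⟨SixStateMachine.Cfg4_zero, SixStateMachine.Cfg4_two, SixStateMachine.Cfg4_three,
    fun k => ⟨SixStateMachine.Cfg4_three_mul_add_one k,
      SixStateMachine.Cfg4_nine_mul_add_five k, SixStateMachine.Cfg4_nine_mul_add_six k,
      SixStateMachine.Cfg4_nine_mul_add_eight k, SixStateMachine.Cfg4_nine_mul_add_nine k,
      SixStateMachine.Cfg4_nine_mul_add_eleven k, SixStateMachine.Cfg4_nine_mul_add_twelve k⟩⟩
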